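/- For every ε > 0 there exists δ > 0 such that for every α ∈ (0,δ) and every τ ∈ (−1,0) with c(α,τ) = 0, one has τ < −1 + ε. (This expresses the limit τ₁(α) → −1 as α → 0⁺, where τ₁(α) is the unique zero of c(α,·) in (−1,0) for α ∈ (0,α₀).) -/

import Mathlib

open MeasureTheory Real Set

noncomputable def c (α τ : ℝ) : ℝ :=
  ∫ t in Set.Ioi (0:ℝ), (|1 - t| ^ τ + (1 + t) ^ τ - 2) / t ^ (1 + 2 * α)

lemma rpow_sub_one_le_div_mul {a s τ : ℝ} (ha : 0 < a) (hs : s < 0) (hsτ : s ≤ τ) (hτ : τ ≤ 0) :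
    a ^ τ - 1 ≤ τ / s * (a ^ s - 1) := by
  have h1 : 0 ≤ τ / s := div_nonneg_of_nonpos hτ hs.le
  have h2 : τ / s ≤ 1 := (div_le_one_of_neg hs).2 hsτ
  have h3 := rpow_one_add_le_one_add_mul_self (s := a ^ s - 1)
    (by linarith [Real.rpow_pos_of_pos ha s]) h1 h2
  rw [add_sub_cancel, ← Real.rpow_mul ha.le, mul_div_cancel₀ _ hs.ne] at h3
  linarith

lemma integrand_le_div_mul {t s τ : ℝ} (α : ℝ) (ht : 0 < t) (ht1 : t ≠ 1) (hs : s < 0)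
    (hsτ : s ≤ τ) (hτ : τ ≤ 0) :
    (|1 - t| ^ τ + (1 + t) ^ τ - 2) / t ^ (1 + 2 * α) ≤
      τ / s * ((|1 - t| ^ s + (1 + t) ^ s - 2) / t ^ (1 + 2 * α)) := by
  have h1 := rpow_sub_one_le_div_mul (abs_pos.2 (sub_ne_zero.2 ht1.symm)) hs hsτ hτ
  have h2 := rpow_sub_one_le_div_mul (by linarith : 0 < 1 + t) hs hsτ hτ
  rw [← mul_div_assoc]
  have := Real.rpow_pos_of_pos ht (1 + 2 * α)
  gcongr
  linarith

lemma abs_second_difference_rpow_le {t τ : ℝ} (ht : 0 < t) (ht2 : t ≤ 1 / 2) (hτ : -1 < τ)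
    (hτ0 : τ < 0) : |(|1 - t| ^ τ + (1 + t) ^ τ - 2)| ≤ 3 * t ^ 2 := by
  have hm : 0 < 1 - t := by linarith
  have hp : 0 < 1 + t := by linarith
  rw [abs_of_pos hm]
  have h1 := rpow_sub_one_le_div_mul hm (by norm_num : (-1 : ℝ) < 0) hτ.le hτ0.le
  have h2 := rpow_sub_one_le_div_mul hp (by norm_num : (-1 : ℝ) < 0) hτ.le hτ0.le
  have hx := Real.rpow_pos_of_pos hm τ
  have hy := Real.rpow_pos_of_pos hp τ
  have hxy : 1 ≤ (1 - t) ^ τ * (1 + t) ^ τ := by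
    rw [← Real.mul_rpow hm.le hp.le]
    exact Real.one_le_rpow_of_pos_of_le_one_of_nonpos (by positivity) (by nlinarith) hτ0.le
  have hlow : 0 ≤ (1 - t) ^ τ + (1 + t) ^ τ - 2 := by
    nlinarith [sq_nonneg ((1 - t) ^ τ - (1 + t) ^ τ)]
  rw [abs_of_nonneg hlow]
  rw [Real.rpow_neg_one] at h1 h2
  have h3 : (1 - t)⁻¹ + (1 + t)⁻¹ - 2 = 2 * t ^ 2 / (1 - t ^ 2) := by
    have : 1 - t ^ 2 ≠ 0 := by nlinarith
    field_simp
    ring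
  have h4 : 2 * t ^ 2 / (1 - t ^ 2) ≤ 3 * t ^ 2 := by
    rw [div_le_iff₀ (by nlinarith)]
    nlinarith [mul_nonneg (sq_nonneg t) (by nlinarith : (0 : ℝ) ≤ 1 - 3 * t ^ 2)]
  have h5 : 0 ≤ (1 - t)⁻¹ + (1 + t)⁻¹ - 2 := by
    rw [h3]; exact div_nonneg (by positivity) (by nlinarith)
  rw [div_neg, div_one] at h1 h2
  nlinarith

lemma abs_integrand_le {t τ α : ℝ} (ht : 0 < t) (hτ : -1 < τ) (hτ0 : τ < 0) (hα : 0 < α)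
    (hα2 : α ≤ 1 / 2) :
    |(|1 - t| ^ τ + (1 + t) ^ τ - 2) / t ^ (1 + 2 * α)| ≤ 15 + 4 * |1 - t| ^ τ := by
  have hx : 0 ≤ |1 - t| ^ τ := Real.rpow_nonneg (abs_nonneg _) τ
  have hd := Real.rpow_pos_of_pos ht (1 + 2 * α)
  rw [abs_div, abs_of_pos hd, div_le_iff₀ hd]
  rcases le_total t (1 / 2) with h | h
  · have h1 := abs_second_difference_rpow_le ht h hτ hτ0
    have h2 : t ^ 2 ≤ t ^ (1 + 2 * α) := by
      rw [← Real.rpow_two]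
      exact Real.rpow_le_rpow_of_exponent_ge ht (by linarith) (by linarith)
    nlinarith
  · have hy : (1 + t) ^ τ ≤ 1 := Real.rpow_le_one_of_one_le_of_nonpos (by linarith) hτ0.le
    have hy0 : 0 < (1 + t) ^ τ := Real.rpow_pos_of_pos (by linarith) τ
    have h2 : (1 / 4 : ℝ) ≤ t ^ (1 + 2 * α) := by
      calc (1 / 4 : ℝ) = (1 / 2 : ℝ) ^ (2 : ℝ) := by norm_num
        _ ≤ (1 / 2 : ℝ) ^ (1 + 2 * α) :=
          Real.rpow_le_rpow_of_exponent_ge (by norm_num) (by norm_num) (by linarith)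
        _ ≤ t ^ (1 + 2 * α) := Real.rpow_le_rpow (by norm_num) h (by linarith)
    have h3 : |(|1 - t| ^ τ + (1 + t) ^ τ - 2)| ≤ |1 - t| ^ τ + 3 := by
      rw [abs_le]; constructor <;> linarith
    nlinarith

lemma integrableOn_abs_one_sub_rpow {τ T : ℝ} (hτ : -1 < τ) (hT : 1 ≤ T) :
    IntegrableOn (fun t : ℝ => |1 - t| ^ τ) (Ioc 0 T) := by
  rw [← Ioc_union_Ioc_eq_Ioc zero_le_one hT]
  refine IntegrableOn.union ?_ ?_
  · have h := (intervalIntegral.intervalIntegrable_rpow' (a := 1) (b := 0) hτ).comp_sub_left 1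
    rw [sub_self, sub_zero, intervalIntegrable_iff_integrableOn_Ioc_of_le zero_le_one] at h
    refine h.congr_fun (fun t ht => ?_) measurableSet_Ioc
    simp only [abs_of_nonneg (sub_nonneg.2 ht.2)]
  · have h := (intervalIntegral.intervalIntegrable_rpow' (a := 0) (b := T - 1) hτ).comp_sub_right 1
    rw [zero_add, sub_add_cancel, intervalIntegrable_iff_integrableOn_Ioc_of_le hT] at h
    refine h.congr_fun (fun t ht => ?_) measurableSet_Ioc
    simp only [abs_sub_comm 1 t, abs_of_nonneg (sub_nonneg.2 ht.1.le)]

lemma integrableOn_bound {τ T : ℝ} (hτ : -1 < τ) (hT : 1 ≤ T) :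
    IntegrableOn (fun t : ℝ => 15 + 4 * |1 - t| ^ τ) (Ioc 0 T) :=
  IntegrableOn.add (integrableOn_const (by simp)) ((integrableOn_abs_one_sub_rpow hτ hT).const_mul 4)

lemma integrableOn_integrand {τ α : ℝ} (hτ : -1 < τ) (hτ0 : τ < 0) (hα : 0 < α)
    (hα2 : α ≤ 1 / 2) :
    IntegrableOn (fun t : ℝ => (|1 - t| ^ τ + (1 + t) ^ τ - 2) / t ^ (1 + 2 * α)) (Ioi 0) := by
  have hmeas : Measurable (fun t : ℝ => (|1 - t| ^ τ + (1 + t) ^ τ - 2) / t ^ (1 + 2 * α)) := by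
    fun_prop
  rw [← Ioc_union_Ioi_eq_Ioi (zero_le_two : (0 : ℝ) ≤ 2)]
  refine IntegrableOn.union ?_ ?_
  · refine (integrableOn_bound hτ one_le_two).mono' hmeas.aestronglyMeasurable ?_
    filter_upwards [ae_restrict_mem measurableSet_Ioc] with t ht
    exact abs_integrand_le ht.1 hτ hτ0 hα hα2
  · have h := (integrableOn_Ioi_rpow_of_lt (by linarith : -(1 + 2 * α) < -1)
      (zero_lt_two : (0 : ℝ) < 2)).const_mul 2
    refine Integrable.mono' h hmeas.aestronglyMeasurable ?_
    filter_upwards [ae_restrict_mem measurableSet_Ioi] with t (ht : 2 < t)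
    have ht0 : 0 < t := by linarith
    have hd := Real.rpow_pos_of_pos ht0 (1 + 2 * α)
    have hx : |1 - t| ^ τ ≤ 1 := Real.rpow_le_one_of_one_le_of_nonpos
      (by rw [abs_sub_comm]; exact le_trans (by linarith) (le_abs_self _)) hτ0.le
    have hx0 : 0 ≤ |1 - t| ^ τ := Real.rpow_nonneg (abs_nonneg _) τ
    have hy : (1 + t) ^ τ ≤ 1 := Real.rpow_le_one_of_one_le_of_nonpos (by linarith) hτ0.le
    have hy0 : 0 < (1 + t) ^ τ := Real.rpow_pos_of_pos (by linarith) τ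
    rw [Real.norm_eq_abs, abs_div, abs_of_pos hd, Real.rpow_neg ht0.le, ← div_eq_mul_inv]
    gcongr
    rw [abs_le]; constructor <;> linarith

lemma c_le_div_mul {α s τ : ℝ} (hα : 0 < α) (hα2 : α ≤ 1 / 2) (hs : -1 < s) (hsτ : s ≤ τ)
    (hτ : τ < 0) : c α τ ≤ τ / s * c α s := by
  have hs0 : s < 0 := hsτ.trans_lt hτ
  unfold c
  rw [← integral_const_mul]
  refine integral_mono_ae (integrableOn_integrand (hs.trans_le hsτ) hτ hα hα2)
    ((integrableOn_integrand hs hs0 hα hα2).const_mul _) ?_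
  filter_upwards [ae_restrict_mem measurableSet_Ioi,
    ae_restrict_of_ae (measure_eq_zero_iff_ae_notMem.1 (measure_singleton (μ := volume) (1 : ℝ)))]
    with t ht ht1
  exact integrand_le_div_mul α ht ht1 hs0 hsτ hτ.le

lemma exists_forall_c_neg {s : ℝ} (hs : -1 < s) (hs0 : s < 0) :
    ∃ δ > (0 : ℝ), δ ≤ 1 / 2 ∧ ∀ α ∈ Ioo (0 : ℝ) δ, c α s < 0 := by
  set T : ℝ := 1 + 2 ^ (-s⁻¹) with hTdef
  have hT2 : 2 ≤ T := by
    have := Real.one_le_rpow (one_le_two : (1 : ℝ) ≤ 2) (neg_nonneg.2 (inv_lt_zero.2 hs0).le)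
    linarith
  have hT0 : 0 < T := by linarith
  have hTs : (T - 1) ^ s = 1 / 2 := by
    rw [hTdef, add_sub_cancel_left, ← Real.rpow_mul zero_le_two, neg_mul, inv_mul_cancel₀ hs0.ne,
      Real.rpow_neg_one, one_div]
  set K : ℝ := ∫ t in Ioc 0 T, (15 + 4 * |1 - t| ^ s) with hK
  have hK0 : 0 ≤ K := setIntegral_nonneg measurableSet_Ioc fun t _ => by positivity
  refine ⟨min (1 / 2) (1 / (2 * K * T + 1)), by positivity, min_le_left _ _, fun α hα => ?_⟩
  have hα0 := hα.1
  have hα2 : α < 1 / 2 := hα.2.trans_le (min_le_left _ _)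
  have hαK : α * (2 * K * T + 1) < 1 :=
    (lt_div_iff₀ (by positivity)).1 (hα.2.trans_le (min_le_right _ _))
  have hint := integrableOn_integrand hs hs0 hα0 hα2.le
  have hIoc := hint.mono_set (Ioc_subset_Ioi_self : Ioc 0 T ⊆ Ioi 0)
  have hIoi := hint.mono_set (Ioi_subset_Ioi hT0.le)
  have hlt : -(1 + 2 * α) < -1 := by linarith
  have hbody : ∫ t in Ioc 0 T, (|1 - t| ^ s + (1 + t) ^ s - 2) / t ^ (1 + 2 * α) ≤ K :=
    setIntegral_mono_on hIoc (integrableOn_bound hs (by linarith)) measurableSet_Ioc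
      fun t ht => (le_abs_self _).trans (abs_integrand_le ht.1 hs hs0 hα0 hα2.le)
  have htail : ∫ t in Ioi T, (|1 - t| ^ s + (1 + t) ^ s - 2) / t ^ (1 + 2 * α) ≤
      ∫ t in Ioi T, -(t ^ (-(1 + 2 * α))) := by
    refine setIntegral_mono_on hIoi (integrableOn_Ioi_rpow_of_lt hlt hT0).neg measurableSet_Ioi
      fun t (ht : T < t) => ?_
    have ht0 : 0 < t := by linarith
    have hx : |1 - t| ^ s ≤ 1 / 2 := by
      rw [abs_sub_comm, abs_of_pos (by linarith), ← hTs]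
      exact Real.rpow_le_rpow_of_nonpos (by linarith) (by linarith) hs0.le
    have hy : (1 + t) ^ s ≤ 1 / 2 := by
      rw [← hTs]
      exact Real.rpow_le_rpow_of_nonpos (by linarith) (by linarith) hs0.le
    rw [Real.rpow_neg ht0.le, ← one_div, ← neg_div]
    have := Real.rpow_pos_of_pos ht0 (1 + 2 * α)
    gcongr
    linarith
  rw [integral_neg, integral_Ioi_rpow_of_lt hlt hT0] at htail
  have hTα : T⁻¹ ≤ T ^ (-(1 + 2 * α) + 1) := by
    rw [← Real.rpow_neg_one]
    exact Real.rpow_le_rpow_of_exponent_le (by linarith) (by linarith)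
  have hKlt : K < T ^ (-(1 + 2 * α) + 1) / (2 * α) := by
    rw [lt_div_iff₀ (by positivity)]
    refine lt_of_lt_of_le ?_ hTα
    rw [← one_div, lt_div_iff₀ hT0]
    linarith
  have hden : -(1 + 2 * α) + 1 = -(2 * α) := by ring
  rw [hden] at htail hKlt
  rw [neg_div_neg_eq] at htail
  unfold c
  rw [← Ioc_union_Ioi_eq_Ioi hT0.le, setIntegral_union
    (Ioc_disjoint_Ioi le_rfl) measurableSet_Ioi hIoc hIoi]
  linarith

theorem zeros_of_c_tendsto_neg_one :
    ∀ ε > (0:ℝ), ∃ δ > (0:ℝ), ∀ α ∈ Set.Ioo (0:ℝ) δ,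
      ∀ τ ∈ Set.Ioo (-1:ℝ) 0, c α τ = 0 → τ < -1 + ε := by
  intro ε hε
  rcases le_or_gt 1 ε with h1 | h1
  · exact ⟨1, one_pos, fun α _ τ hτ _ => by linarith [hτ.2]⟩
  obtain ⟨δ, hδ, hδ2, hneg⟩ := exists_forall_c_neg (s := -1 + ε) (by linarith) (by linarith)
  refine ⟨δ, hδ, fun α hα τ hτ hc => ?_⟩
  by_contra! hle
  have h := c_le_div_mul hα.1 (hα.2.le.trans hδ2) (by linarith) hle hτ.2
  have hpos : 0 < τ / (-1 + ε) := div_pos_of_neg_of_neg hτ.2 (by linarith)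
  have := mul_neg_of_pos_of_neg hpos (hneg α hα)
  linarith
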